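/- Let 0 < α < r and σ, β, E, δ, I > 0, set θ := 2α(2r+δ)/((r−α)(r+α)(r+δ−α)(r+δ+α)) and ρ := 1/((r+δ+α)(r+α)), and define q(z,π) := βE·e^{−z}·(π/(1−π))^{σ²/(2α)}·( ((α−r)θ + 2αρ)·π − (α+r)ρ ) + r·I for (z,π) ∈ ℝ×(0,1). Then for every z ∈ ℝ there exists a unique m(z) ∈ (0,1) such that q(z, m(z)) = 0; moreover q(z,π) > 0 for all π ∈ (0, m(z)), q(z,π) < 0 for all π ∈ (m(z), 1), and m(z) = inf{ π ∈ (0,1) : q(z,π) < 0 }. -/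

import Mathlib

theorem strictMonoOn_odds : StrictMonoOn (fun x : ℝ => x / (1 - x)) (Set.Ico 0 1) := by
  intro x hx y hy hxy
  have hx' : 0 < 1 - x := sub_pos.2 hx.2
  have hy' : 0 < 1 - y := sub_pos.2 hy.2
  change x / (1 - x) < y / (1 - y)
  rw [div_lt_div_iff₀ hx' hy']
  linarith

theorem strictMonoOn_odds_rpow_mul_affine {k a b : ℝ} (hk : 0 < k) (ha : 0 ≤ a) (hb : 0 < b) :
    StrictMonoOn (fun x : ℝ => (x / (1 - x)) ^ k * (a * x + b)) (Set.Ico 0 1) := by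
  intro x hx y hy hxy
  have hx0 : 0 ≤ x / (1 - x) := div_nonneg hx.1 (sub_nonneg.2 hx.2.le)
  have hodds : (x / (1 - x)) ^ k < (y / (1 - y)) ^ k :=
    Real.rpow_lt_rpow hx0 (strictMonoOn_odds hx hy hxy) hk
  have hax : 0 ≤ a * x := mul_nonneg ha hx.1
  have hle : a * x + b ≤ a * y + b := by gcongr
  exact mul_lt_mul hodds hle (by linarith) ((Real.rpow_nonneg hx0 k).trans hodds.le)

theorem continuousOn_odds_rpow_mul_affine {k : ℝ} (hk : 0 ≤ k) (a b : ℝ) :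
    ContinuousOn (fun x : ℝ => (x / (1 - x)) ^ k * (a * x + b)) (Set.Ico 0 1) := by
  refine ContinuousOn.mul (ContinuousOn.rpow_const ?_ fun _ _ => Or.inr hk) (by fun_prop)
  exact continuousOn_id.div (by fun_prop) fun x hx => (sub_pos.2 hx.2).ne'

/-- The function `(x / (1 - x)) ^ k * (a * x + b)` takes every positive value on `(0, 1)`. -/
theorem exists_odds_rpow_mul_affine_eq {k a b c : ℝ} (hk : 0 < k) (ha : 0 ≤ a) (hb : 0 < b)
    (hc : 0 < c) :
    ∃ x ∈ Set.Ioo (0 : ℝ) 1, (x / (1 - x)) ^ k * (a * x + b) = c := by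
  set t : ℝ := (c / b) ^ k⁻¹
  have htpos : 0 < t := Real.rpow_pos_of_pos (div_pos hc hb) _
  have htk : t ^ k = c / b := Real.rpow_inv_rpow (div_pos hc hb).le hk.ne'
  set y : ℝ := t / (1 + t) with hy
  have hypos : 0 < y := by positivity
  have hy1 : y < 1 := (div_lt_one (by linarith)).2 (by linarith)
  have hodds : y / (1 - y) = t := by
    rw [hy]
    field_simp
    ring
  have hval : c ≤ (y / (1 - y)) ^ k * (a * y + b) := by
    rw [hodds, htk]
    calc c = c / b * b := by field_simp
      _ ≤ c / b * (a * y + b) := by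
        gcongr
        exact le_add_of_nonneg_left (mul_nonneg ha hypos.le)
  have hcont := (continuousOn_odds_rpow_mul_affine hk.le a b).mono
    (Set.Icc_subset_Ico_right hy1)
  obtain ⟨x, hx, hxc⟩ := intermediate_value_Icc hypos.le hcont
    (show c ∈ Set.Icc _ _ from ⟨by simp [Real.zero_rpow hk.ne', hc.le], hval⟩)
  refine ⟨x, ⟨hx.1.lt_of_ne ?_, hx.2.trans_lt hy1⟩, hxc⟩
  rintro rfl
  simp [Real.zero_rpow hk.ne', hc.ne] at hxc

theorem slope_coefficient_eq {r α δ : ℝ} (hα : 0 < α) (hαr : α < r) (hδ : 0 < δ) :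
    (α - r) * (2 * α * (2 * r + δ) / ((r - α) * (r + α) * (r + δ - α) * (r + δ + α)))
      + 2 * α * (1 / ((r + δ + α) * (r + α)))
      = -(2 * α / ((r + δ + α) * (r + δ - α))) := by
  have h1 : r - α ≠ 0 := by linarith
  have h2 : r + α ≠ 0 := by linarith
  have h3 : r + δ - α ≠ 0 := by linarith
  have h4 : r + δ + α ≠ 0 := by linarith
  field_simp
  ring


/-- Existence, uniqueness and characterisation of the lower threshold `m(z)`: for each `z`
there is a unique `m(z) ∈ (0,1)` with `q(z, m(z)) = 0`; `q(z,·)` is positive below `m(z)` and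
negative above it, and `m(z) = inf {π ∈ (0,1) : q(z,π) < 0}`. -/
theorem lower_threshold_exists_unique (r α σ β E δ I : ℝ)
    (hα : 0 < α) (hαr : α < r) (hσ : 0 < σ) (hβ : 0 < β) (hE : 0 < E)
    (hδ : 0 < δ) (hI : 0 < I)
    (θ ρ : ℝ)
    (hθ : θ = 2 * α * (2 * r + δ) / ((r - α) * (r + α) * (r + δ - α) * (r + δ + α)))
    (hρ : ρ = 1 / ((r + δ + α) * (r + α)))
    (q : ℝ → ℝ → ℝ)
    (hq : ∀ z π, q z π = β * E * Real.exp (-z) * (π / (1 - π)) ^ (σ ^ 2 / (2 * α))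
      * (((α - r) * θ + 2 * α * ρ) * π - (α + r) * ρ) + r * I) :
    ∀ z : ℝ, ∃ mz : ℝ,
      mz ∈ Set.Ioo (0 : ℝ) 1
      ∧ q z mz = 0
      ∧ (∀ π ∈ Set.Ioo (0 : ℝ) mz, 0 < q z π)
      ∧ (∀ π ∈ Set.Ioo mz (1 : ℝ), q z π < 0)
      ∧ mz = sInf {π : ℝ | π ∈ Set.Ioo (0 : ℝ) 1 ∧ q z π < 0}
      ∧ (∀ m' ∈ Set.Ioo (0 : ℝ) 1, q z m' = 0 → m' = mz) := by
  intro z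
  set a : ℝ := 2 * α / ((r + δ + α) * (r + δ - α))
  set b : ℝ := (α + r) * ρ with hb_def
  set k : ℝ := σ ^ 2 / (2 * α)
  set C : ℝ := β * E * Real.exp (-z)
  have hr : 0 < r := hα.trans hαr
  have ha : 0 < a := by
    have : 0 < r + δ - α := by linarith
    positivity
  have hb : 0 < b := by rw [hb_def, hρ]; positivity
  have hk : 0 < k := by positivity
  have hC : 0 < C := by positivity
  have hrI : 0 < r * I / C := by positivity
  set g : ℝ → ℝ := fun x => (x / (1 - x)) ^ k * (a * x + b) with hg
  have hqg : ∀ x, q z x = C * (r * I / C - g x) := by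
    intro x
    rw [hq, hθ, hρ, slope_coefficient_eq hα hαr hδ, mul_sub C, mul_div_cancel₀ _ hC.ne']
    simp only [hg]
    ring
  have hmono : StrictMonoOn g (Set.Ico 0 1) := strictMonoOn_odds_rpow_mul_affine hk ha.le hb
  obtain ⟨m, hm, hgm⟩ : ∃ m ∈ Set.Ioo (0 : ℝ) 1, g m = r * I / C :=
    exists_odds_rpow_mul_affine_eq hk ha.le hb hrI
  have hm' : m ∈ Set.Ico (0 : ℝ) 1 := Set.Ioo_subset_Ico_self hm
  have hpos : ∀ x ∈ Set.Ioo (0 : ℝ) m, 0 < q z x := by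
    intro x hx
    rw [hqg, ← hgm]
    exact mul_pos hC (sub_pos.2 (hmono ⟨hx.1.le, hx.2.trans hm.2⟩ hm' hx.2))
  have hneg : ∀ x ∈ Set.Ioo m (1 : ℝ), q z x < 0 := by
    intro x hx
    rw [hqg, ← hgm]
    exact mul_neg_of_pos_of_neg hC
      (sub_neg.2 (hmono hm' ⟨hm.1.le.trans hx.1.le, hx.2⟩ hx.1))
  have hzero : q z m = 0 := by rw [hqg, hgm, sub_self, mul_zero]
  refine ⟨m, hm, hzero, hpos, hneg, ?_, ?_⟩
  · have hset : {x : ℝ | x ∈ Set.Ioo (0 : ℝ) 1 ∧ q z x < 0} = Set.Ioo m 1 := by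
      ext x
      refine ⟨fun ⟨hx, hqx⟩ => ⟨?_, hx.2⟩, fun hx => ⟨⟨hm.1.trans hx.1, hx.2⟩, hneg x hx⟩⟩
      rcases lt_trichotomy x m with h | rfl | h
      · exact absurd (hpos x ⟨hx.1, h⟩) hqx.not_gt
      · exact absurd hzero hqx.ne
      · exact h
    rw [hset, csInf_Ioo hm.2]
  · intro x hx hqx
    rcases lt_trichotomy x m with h | h | h
    · exact absurd hqx (hpos x ⟨hx.1, h⟩).ne'
    · exact h
    · exact absurd hqx (hneg x ⟨h, hx.2⟩).ne
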